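/- Let p ≥ 2, let Σ be a p×p real symmetric positive definite matrix with an orthonormal basis of eigenvectors v₁, …, vₚ and corresponding eigenvalues λ₁ ≥ λ₂ ≥ … ≥ λₚ > 0, let μ ∈ ℝᵖ, and let g : ℝ → ℝ be twice continuously differentiable with g′(t) < 0 and g″(t) ≥ 0 for all t ≥ 0. Set f(x) = g((x − μ)ᵀΣ⁻¹(x − μ)). Then for every c ∈ ℝ, the point x = μ + c·v₁ satisfies the density-ridge conditions: Hess f(x)·∇f(x) = α·∇f(x) where α = (4c²/λ₁²)·g″(c²/λ₁) + (2/λ₁)·g′(c²/λ₁); α is the largest eigenvalue of Hess f(x), the remaining eigenvalues (with eigenvectors v₂, …, vₚ) are (2/λᵢ)·g′(c²/λ₁) for i = 2, …, p, and each of these remaining eigenvalues is strictly negative. -/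

import Mathlib

open Matrix

/-- Gradient of `f : ℝᵖ → ℝ` at `x`: the vector of partial derivatives. -/
noncomputable def grad {p : ℕ} (f : (Fin p → ℝ) → ℝ) (x : Fin p → ℝ) : Fin p → ℝ :=
  fun j => fderiv ℝ f x (Pi.single j 1)

/-- Hessian matrix of `f : ℝᵖ → ℝ` at `x`: the matrix of second partial derivatives. -/
noncomputable def hess {p : ℕ} (f : (Fin p → ℝ) → ℝ) (x : Fin p → ℝ) :
    Matrix (Fin p) (Fin p) ℝ :=
  Matrix.of fun i j => fderiv ℝ (fun y => fderiv ℝ f y (Pi.single j 1)) x (Pi.single i 1)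

/-- `t` is an eigenvalue of the real matrix `H`. -/
def IsEigenvalue {p : ℕ} (H : Matrix (Fin p) (Fin p) ℝ) (t : ℝ) : Prop :=
  ∃ w : Fin p → ℝ, w ≠ 0 ∧ H.mulVec w = t • w

lemma hasFDerivAt_mulVec_sub {p : ℕ} (A : Matrix (Fin p) (Fin p) ℝ) (μ x : Fin p → ℝ)
    (i : Fin p) :
    HasFDerivAt (fun y : Fin p → ℝ => A.mulVec (y - μ) i)
      ((ContinuousLinearMap.proj (R := ℝ) (φ := fun _ => ℝ) i).comp
        (LinearMap.toContinuousLinearMap A.mulVecLin)) x :=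
  hasFDerivAt_pi'.1 ((LinearMap.toContinuousLinearMap A.mulVecLin).hasFDerivAt.comp x
    ((hasFDerivAt_id x).sub_const μ)) i

/-- Gradient of a shifted symmetric quadratic form. -/
lemma hasFDerivAt_quadForm {p : ℕ} {A : Matrix (Fin p) (Fin p) ℝ} (hA : Aᵀ = A)
    (μ x : Fin p → ℝ) :
    HasFDerivAt (fun y : Fin p → ℝ => (y - μ) ⬝ᵥ A.mulVec (y - μ))
      (∑ i, (2 * A.mulVec (x - μ) i) • ContinuousLinearMap.proj (R := ℝ) (φ := fun _ => ℝ) i) x := by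
  have hsum := HasFDerivAt.fun_sum (u := Finset.univ) fun i _ =>
    ((hasFDerivAt_apply (𝕜 := ℝ) (F' := fun _ : Fin p => ℝ) i x).sub_const (μ i)).mul
      (hasFDerivAt_mulVec_sub A μ x i)
  refine hsum.congr_fderiv ?_
  ext w
  have hswap : (x - μ) ⬝ᵥ A.mulVec w = A.mulVec (x - μ) ⬝ᵥ w := by
    rw [dotProduct_mulVec, ← mulVec_transpose, hA]
  simp only [dotProduct, Pi.sub_apply] at hswap
  simp [Finset.sum_add_distrib, hswap, two_mul, add_mul]

lemma fderiv_comp_quadForm_single {p : ℕ} {A : Matrix (Fin p) (Fin p) ℝ} (hA : Aᵀ = A)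
    {g : ℝ → ℝ} (hg : Differentiable ℝ g) (μ x : Fin p → ℝ) (j : Fin p) :
    fderiv ℝ (fun y => g ((y - μ) ⬝ᵥ A.mulVec (y - μ))) x (Pi.single j 1) =
      deriv g ((x - μ) ⬝ᵥ A.mulVec (x - μ)) * (2 * A.mulVec (x - μ) j) := by
  refine (congrArg (fun L => L (Pi.single j 1))
    ((hg _).hasDerivAt.comp_hasFDerivAt x (hasFDerivAt_quadForm hA μ x)).fderiv).trans ?_
  simp [Pi.single_apply]

lemma grad_comp_quadForm {p : ℕ} {A : Matrix (Fin p) (Fin p) ℝ} (hA : Aᵀ = A)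
    {g : ℝ → ℝ} (hg : Differentiable ℝ g) (μ x : Fin p → ℝ) :
    grad (fun y => g ((y - μ) ⬝ᵥ A.mulVec (y - μ))) x =
      (2 * deriv g ((x - μ) ⬝ᵥ A.mulVec (x - μ))) • A.mulVec (x - μ) := by
  ext j
  rw [grad, fderiv_comp_quadForm_single hA hg, Pi.smul_apply, smul_eq_mul]
  ring

lemma hess_comp_quadForm {p : ℕ} {A : Matrix (Fin p) (Fin p) ℝ} (hA : Aᵀ = A)
    {g : ℝ → ℝ} (hg : ContDiff ℝ 2 g) (μ x : Fin p → ℝ) :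
    hess (fun y => g ((y - μ) ⬝ᵥ A.mulVec (y - μ))) x =
      (4 * deriv (deriv g) ((x - μ) ⬝ᵥ A.mulVec (x - μ))) •
          vecMulVec (A.mulVec (x - μ)) (A.mulVec (x - μ)) +
        (2 * deriv g ((x - μ) ⬝ᵥ A.mulVec (x - μ))) • A := by
  have hg1 : Differentiable ℝ g := hg.differentiable (by norm_num)
  have hg2 : Differentiable ℝ (deriv g) :=
    (hg.deriv' (n := 1)).differentiable (by norm_num)
  ext i j
  have hmul := ((hg2 _).hasDerivAt.comp_hasFDerivAt x (hasFDerivAt_quadForm hA μ x)).mul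
    ((hasFDerivAt_mulVec_sub A μ x j).const_mul 2)
  have hfun : (fun y => fderiv ℝ (fun y => g ((y - μ) ⬝ᵥ A.mulVec (y - μ))) y (Pi.single j 1)) =
      fun y => deriv g ((y - μ) ⬝ᵥ A.mulVec (y - μ)) * (2 * A.mulVec (y - μ) j) :=
    funext fun y => fderiv_comp_quadForm_single hA hg1 μ y j
  have hsymm : A i j = A j i := congrFun (congrFun hA j) i
  rw [hess, of_apply, hfun]
  refine (congrArg (fun L => L (Pi.single i 1)) hmul.fderiv).trans ?_
  simp [Pi.single_apply, vecMulVec_apply, hsymm]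
  ring

/-- A nonzero vector is not orthogonal to every member of an orthonormal basis. -/
lemma exists_dotProduct_ne_zero {p : ℕ} {v : Fin p → Fin p → ℝ}
    (h_orth : ∀ i j, v i ⬝ᵥ v j = if i = j then 1 else 0) {w : Fin p → ℝ} (hw : w ≠ 0) :
    ∃ i, v i ⬝ᵥ w ≠ 0 := by
  by_contra! h
  have hV : of v * (of v)ᵀ = 1 := by
    ext i j
    simpa [mul_apply, dotProduct, one_apply] using h_orth i j
  have hVw : (of v).mulVec w = 0 := funext h
  apply hw
  rw [← one_mulVec w, ← mul_eq_one_comm.1 hV, ← mulVec_mulVec, hVw, mulVec_zero]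

/-- An orthonormal basis of eigenvectors of a symmetric matrix exhibits all its eigenvalues. -/
lemma IsEigenvalue.exists_eq {p : ℕ} {H : Matrix (Fin p) (Fin p) ℝ} (hH : Hᵀ = H)
    {v : Fin p → Fin p → ℝ} (h_orth : ∀ i j, v i ⬝ᵥ v j = if i = j then 1 else 0)
    {e : Fin p → ℝ} (he : ∀ i, H.mulVec (v i) = e i • v i) {t : ℝ} (ht : IsEigenvalue H t) :
    ∃ i, t = e i := by
  obtain ⟨w, hw, hHw⟩ := ht
  obtain ⟨i, hi⟩ := exists_dotProduct_ne_zero h_orth hw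
  refine ⟨i, mul_right_cancel₀ hi ?_⟩
  calc t * (v i ⬝ᵥ w) = v i ⬝ᵥ H.mulVec w := by rw [hHw, dotProduct_smul, smul_eq_mul]
    _ = H.mulVec (v i) ⬝ᵥ w := by rw [dotProduct_mulVec, ← mulVec_transpose, hH]
    _ = e i * (v i ⬝ᵥ w) := by rw [he, smul_dotProduct, smul_eq_mul]

theorem stmt4 {p : ℕ} (hp : 2 ≤ p) (S : Matrix (Fin p) (Fin p) ℝ) (hS : S.PosDef)
    (v : Fin p → Fin p → ℝ) (lam : Fin p → ℝ)
    (h_orth : ∀ i j, v i ⬝ᵥ v j = if i = j then 1 else 0)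
    (h_eig : ∀ i, S.mulVec (v i) = lam i • v i)
    (h_mono : ∀ i j : Fin p, i ≤ j → lam j ≤ lam i)
    (h_pos : ∀ i, 0 < lam i)
    (μ : Fin p → ℝ) (g : ℝ → ℝ) (hg : ContDiff ℝ 2 g)
    (hg' : ∀ t : ℝ, 0 ≤ t → deriv g t < 0)
    (hg'' : ∀ t : ℝ, 0 ≤ t → 0 ≤ deriv (deriv g) t)
    (f : (Fin p → ℝ) → ℝ)
    (hf : ∀ x, f x = g ((x - μ) ⬝ᵥ S⁻¹.mulVec (x - μ)))
    (i0 : Fin p) (hi0 : (i0 : ℕ) = 0) :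
    ∀ (c : ℝ) (x : Fin p → ℝ) (α : ℝ), x = μ + c • v i0 →
      α = 4 * c ^ 2 / lam i0 ^ 2 * deriv (deriv g) (c ^ 2 / lam i0)
          + 2 / lam i0 * deriv g (c ^ 2 / lam i0) →
      -- the point satisfies the density-ridge conditions:
      (hess f x).mulVec (grad f x) = α • grad f x ∧
      -- α is the largest eigenvalue of the Hessian at x:
      IsEigenvalue (hess f x) α ∧
      (∀ t, IsEigenvalue (hess f x) t → t ≤ α) ∧
      -- the remaining eigenvalues, with eigenvectors v i (i ≠ i0), are
      -- (2/λᵢ)·g′(c²/λ₁), and each of them is strictly negative: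
      (∀ i : Fin p, i ≠ i0 →
        (hess f x).mulVec (v i) = (2 / lam i * deriv g (c ^ 2 / lam i0)) • v i ∧
        2 / lam i * deriv g (c ^ 2 / lam i0) < 0) ∧
      (∀ t, IsEigenvalue (hess f x) t →
        t = α ∨ ∃ i : Fin p, i ≠ i0 ∧ t = 2 / lam i * deriv g (c ^ 2 / lam i0)) := by
  rintro c x α rfl hα
  obtain rfl : f = fun x => g ((x - μ) ⬝ᵥ S⁻¹.mulVec (x - μ)) := funext hf
  have hA : (S⁻¹)ᵀ = S⁻¹ := by
    simpa [IsHermitian, conjTranspose_eq_transpose_of_trivial] using hS.isHermitian.inv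
  have hinv : ∀ i, S⁻¹.mulVec (v i) = (lam i)⁻¹ • v i := fun i => by
    have hSv : S⁻¹.mulVec (S.mulVec (v i)) = v i := by
      rw [mulVec_mulVec, nonsing_inv_mul S (isUnit_iff_ne_zero.2 hS.det_pos.ne'), one_mulVec]
    rw [eq_inv_smul_iff₀ (h_pos i).ne', ← mulVec_smul, ← h_eig, hSv]
  have hgrad := grad_comp_quadForm hA (hg.differentiable (by norm_num)) μ (μ + c • v i0)
  have hhess := hess_comp_quadForm hA hg μ (μ + c • v i0)
  have hq : (c • v i0) ⬝ᵥ S⁻¹.mulVec (c • v i0) = c ^ 2 / lam i0 := by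
    rw [mulVec_smul, hinv]
    simp [h_orth]
    ring
  rw [add_sub_cancel_left, hq, mulVec_smul, hinv] at hgrad hhess
  set H := hess (fun x => g ((x - μ) ⬝ᵥ S⁻¹.mulVec (x - μ))) (μ + c • v i0)
  set q := c ^ 2 / lam i0
  have hq0 : 0 ≤ q := div_nonneg (sq_nonneg c) (h_pos i0).le
  have hHsymm : Hᵀ = H := by
    rw [hhess, transpose_add, transpose_smul, transpose_smul, hA, transpose_vecMulVec]
  have hHv : ∀ i, H.mulVec (v i) =
      (if i = i0 then α else 2 / lam i * deriv g q) • v i := fun i => by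
    rw [hhess, add_mulVec, smul_mulVec, smul_mulVec, hinv, vecMulVec_mulVec]
    ext k
    split_ifs with hi
    · subst hi
      simp [h_orth, hα]
      ring
    · simp [h_orth, Ne.symm hi]
      ring
  have hv0 : v i0 ≠ 0 := fun h => by simpa [h] using h_orth i0 i0
  have hH0 : H.mulVec (v i0) = α • v i0 := by simpa using hHv i0
  have hcases : ∀ t, IsEigenvalue H t →
      t = α ∨ ∃ i : Fin p, i ≠ i0 ∧ t = 2 / lam i * deriv g q := fun t ht => by
    obtain ⟨i, hi⟩ := ht.exists_eq hHsymm h_orth hHv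
    by_cases h : i = i0
    · exact Or.inl (by simpa [h] using hi)
    · exact Or.inr ⟨i, h, by simpa [h] using hi⟩
  have hle : ∀ i, 2 / lam i * deriv g q ≤ α := fun i => by
    have h1 : 2 / lam i0 ≤ 2 / lam i :=
      div_le_div_of_nonneg_left zero_le_two (h_pos i) (h_mono i0 i (by simp [Fin.le_def, hi0]))
    have h2 : 0 ≤ 4 * c ^ 2 / lam i0 ^ 2 * deriv (deriv g) q :=
      mul_nonneg (by positivity) (hg'' q hq0)
    have h3 := mul_le_mul_of_nonpos_right h1 (hg' q hq0).le
    linarith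
  refine ⟨?_, ⟨v i0, hv0, hH0⟩, fun t ht => ?_, fun i hi => ⟨by simpa [hi] using hHv i, ?_⟩, hcases⟩
  · rw [hgrad, mulVec_smul, mulVec_smul, mulVec_smul, hH0]
    simp only [smul_comm α]
  · obtain rfl | ⟨i, -, rfl⟩ := hcases t ht
    exacts [le_rfl, hle i]
  · exact mul_neg_of_pos_of_neg (div_pos two_pos (h_pos i)) (hg' q hq0)
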